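/- Let ω be a radial weight in the class D̂. Then the moments ω_x = ∫_0^1 s^x ω(s) ds satisfy ω_x ≍ ω̂(1 - 1/x) for all x ≥ 1; that is, there exist positive constants c, C depending only on ω such that c·ω̂(1-1/x) ≤ ω_x ≤ C·ω̂(1-1/x) for all x ≥ 1. -/

import Mathlib

open MeasureTheory Set

/-- Multiplying by `s ^ x` with `x ≥ 0` preserves integrability on `(0, 1]`. -/
theorem integrableOn_rpow_mul {ω : ℝ → ℝ} (hI : IntegrableOn ω (Ioc (0:ℝ) 1)) {x : ℝ}
    (hx : 0 ≤ x) : IntegrableOn (fun s => s ^ x * ω s) (Ioc (0:ℝ) 1) := by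
  refine Integrable.mono hI ?_ ?_
  · exact (measurable_id.pow_const x).aestronglyMeasurable.mul hI.aestronglyMeasurable
  · filter_upwards [ae_restrict_mem measurableSet_Ioc] with s hs
    rw [norm_mul, Real.norm_of_nonneg (Real.rpow_nonneg hs.1.le x)]
    exact mul_le_of_le_one_left (norm_nonneg _) (Real.rpow_le_one hs.1.le hs.2 hx)

/-- The tail integral of a non-negative function is antitone on `[0, 1]`. -/
theorem setIntegral_Ioc_one_anti {ω : ℝ → ℝ} (hnn : ∀ r, 0 ≤ ω r)
    (hI : IntegrableOn ω (Ioc (0:ℝ) 1)) {a b : ℝ} (ha : 0 ≤ a) (hab : a ≤ b) :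
    ∫ s in Ioc b 1, ω s ≤ ∫ s in Ioc a 1, ω s :=
  setIntegral_mono_set (hI.mono_set (Ioc_subset_Ioc_left ha))
    (Filter.Eventually.of_forall hnn) (Ioc_subset_Ioc_left hab).eventuallyLE

/-- The part of the moment of order `x` carried by `(a, b]` is at most `exp (-y)` times the tail
at `a`, provided `b ≤ 1 - y / x` whenever the interval is non-empty. -/
theorem setIntegral_rpow_mul_le_exp {ω : ℝ → ℝ} (hnn : ∀ r, 0 ≤ ω r)
    (hI : IntegrableOn ω (Ioc (0:ℝ) 1)) {x a b y : ℝ} (hx : 0 < x) (ha : 0 ≤ a) (hb1 : b ≤ 1)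
    (hb : a < b → b ≤ 1 - y / x) :
    ∫ s in Ioc a b, s ^ x * ω s ≤ Real.exp (-y) * ∫ s in Ioc a 1, ω s := by
  have hsub : Ioc a b ⊆ Ioc 0 1 := Ioc_subset_Ioc ha hb1
  calc ∫ s in Ioc a b, s ^ x * ω s ≤ ∫ s in Ioc a b, Real.exp (-y) * ω s := by
        refine setIntegral_mono_on ((integrableOn_rpow_mul hI hx.le).mono_set hsub)
          ((hI.mono_set hsub).const_mul _) measurableSet_Ioc fun s hs => ?_
        refine mul_le_mul_of_nonneg_right ?_ (hnn s)
        have h1 : s ≤ Real.exp (-(y / x)) := by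
          have := Real.add_one_le_exp (-(y / x))
          linarith [hs.2, hb (hs.1.trans_le hs.2)]
        calc s ^ x ≤ Real.exp (-(y / x)) ^ x :=
              Real.rpow_le_rpow (ha.trans hs.1.le) h1 hx.le
          _ = Real.exp (-y) := by
              rw [← Real.exp_mul]; congr 1; field_simp
    _ = Real.exp (-y) * ∫ s in Ioc a b, ω s := integral_const_mul _ _
    _ ≤ Real.exp (-y) * ∫ s in Ioc a 1, ω s := by
        refine mul_le_mul_of_nonneg_left ?_ (Real.exp_pos _).le
        exact setIntegral_mono_set (hI.mono_set (Ioc_subset_Ioc_left ha))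
          (Filter.Eventually.of_forall hnn) (Ioc_subset_Ioc_right hb1).eventuallyLE

/-- `C ^ (k + 1) * exp (-2 ^ k)` decays geometrically in `k`, with ratio `1 / 2`. -/
theorem exists_pow_mul_exp_neg_two_pow_le {C : ℝ} (hC : 0 ≤ C) :
    ∃ A > (0:ℝ), ∀ k : ℕ, C ^ (k + 1) * Real.exp (-2 ^ k) ≤ A * (1 / 2) ^ k := by
  obtain ⟨N, hN⟩ := pow_unbounded_of_one_lt (2 * C) (one_lt_two (α := ℝ))
  have hF : (0:ℝ) < N.factorial := by positivity
  refine ⟨(C + 1) * N.factorial, by positivity, fun k => ?_⟩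
  have hexp : Real.exp (-2 ^ k) ≤ N.factorial / (2 ^ N) ^ k := by
    have h := Real.pow_div_factorial_le_exp ((2:ℝ) ^ k) (by positivity) N
    rw [Real.exp_neg, pow_right_comm]
    calc (Real.exp (2 ^ k))⁻¹ ≤ (((2:ℝ) ^ k) ^ N / N.factorial)⁻¹ :=
          inv_anti₀ (by positivity) h
      _ = _ := by rw [inv_div]
  have hratio : C / 2 ^ N ≤ 1 / 2 := by
    rw [div_le_div_iff₀ (by positivity) two_pos]; linarith
  calc C ^ (k + 1) * Real.exp (-2 ^ k) ≤ C ^ (k + 1) * (N.factorial / (2 ^ N) ^ k) := by gcongr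
    _ = C * N.factorial * (C / 2 ^ N) ^ k := by rw [div_pow, pow_succ]; ring
    _ ≤ (C + 1) * N.factorial * (1 / 2) ^ k := by gcongr; linarith

/-- For ω ∈ D̂ the moments satisfy ω_x ≍ ω̂(1 - 1/x) for x ≥ 1. -/
theorem stmt_1 (ω : ℝ → ℝ) (hnn : ∀ r, 0 ≤ ω r)
    (hInt : IntegrableOn ω (Set.Ico (0:ℝ) 1))
    (What : ℝ → ℝ) (hWhat : ∀ r, What r = ∫ s in Set.Ioc r 1, ω s)
    (hpos : ∀ r ∈ Set.Ico (0:ℝ) 1, 0 < What r)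
    (hD : ∃ C ≥ (1:ℝ), ∀ r ∈ Set.Ico (0:ℝ) 1, What r ≤ C * What ((1 + r) / 2))
    (mom : ℝ → ℝ) (hmom : ∀ x, mom x = ∫ s in Set.Ioc (0:ℝ) 1, s ^ x * ω s) :
    ∃ c > (0:ℝ), ∃ C > (0:ℝ), ∀ x ≥ (1:ℝ),
      c * What (1 - 1 / x) ≤ mom x ∧ mom x ≤ C * What (1 - 1 / x) := by
  obtain ⟨C, hC1, hC⟩ := hD
  have hC0 : 0 < C := by linarith
  have hI : IntegrableOn ω (Ioc (0:ℝ) 1) := by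
    rwa [← integrableOn_Icc_iff_integrableOn_Ioc, integrableOn_Icc_iff_integrableOn_Ico]
  have hanti : ∀ {a b : ℝ}, 0 ≤ a → a ≤ b → What b ≤ What a := fun ha hab => by
    rw [hWhat, hWhat]; exact setIntegral_Ioc_one_anti hnn hI ha hab
  obtain ⟨A, hA, hAk⟩ := exists_pow_mul_exp_neg_two_pow_le hC0.le
  refine ⟨1 / (2 * C), by positivity, 1 + 2 * A, by positivity, fun x hx => ?_⟩
  have hx0 : 0 < x := by linarith
  have hxinv : 1 / x ≤ 1 := (div_le_one hx0).2 hx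
  have hxinv0 : 0 < 1 / x := by positivity
  have hfI := integrableOn_rpow_mul hI hx0.le
  constructor
  · have hr := hC (1 - 1 / x) ⟨by linarith, by linarith⟩
    set t := (1 + (1 - 1 / x)) / 2 with ht
    have ht0 : 0 ≤ t := by linarith
    have hhalf : (1:ℝ) / 2 ≤ t ^ x := by
      have h := one_add_mul_self_le_rpow_one_add (s := -(1 / x) / 2) (by linarith) hx
      have e1 : 1 + x * (-(1 / x) / 2) = 1 / 2 := by field_simp; norm_num
      have e2 : 1 + -(1 / x) / 2 = t := by rw [ht]; ring
      rwa [e1, e2] at h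
    have hlow : 1 / 2 * What t ≤ mom x := by
      rw [hWhat, hmom, ← integral_const_mul]
      calc ∫ s in Ioc t 1, 1 / 2 * ω s ≤ ∫ s in Ioc t 1, s ^ x * ω s := by
            refine setIntegral_mono_on ((hI.mono_set (Ioc_subset_Ioc_left ht0)).const_mul _)
              (hfI.mono_set (Ioc_subset_Ioc_left ht0)) measurableSet_Ioc fun s hs => ?_
            exact mul_le_mul_of_nonneg_right
              (hhalf.trans (Real.rpow_le_rpow ht0 hs.1.le hx0.le)) (hnn s)
        _ ≤ ∫ s in Ioc 0 1, s ^ x * ω s := by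
            refine setIntegral_mono_set hfI ?_ (Ioc_subset_Ioc_left ht0).eventuallyLE
            filter_upwards [ae_restrict_mem measurableSet_Ioc] with s hs
            exact mul_nonneg (Real.rpow_nonneg hs.1.le x) (hnn s)
    calc 1 / (2 * C) * What (1 - 1 / x) ≤ 1 / (2 * C) * (C * What t) := by gcongr
      _ = 1 / 2 * What t := by field_simp
      _ ≤ mom x := hlow
  · set W := What (1 - 1 / x) with hW
    have hW0 : 0 < W := hpos _ ⟨by linarith, by linarith⟩
    let u : ℕ → ℝ := fun k => max 0 (1 - 2 ^ k / x)
    have hu0 : ∀ k, 0 ≤ u k := fun k => le_max_left _ _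
    have hu1 : ∀ k, u k < 1 := fun k =>
      max_lt one_pos (by have : 0 < (2:ℝ) ^ k / x := by positivity
                         linarith)
    have hdouble : ∀ k, (2:ℝ) ^ (k + 1) / x = 2 * (2 ^ k / x) := fun k => by ring
    have hu_succ : ∀ k, u (k + 1) ≤ u k := fun k => by
      refine max_le_max le_rfl ?_
      have : 0 < (2:ℝ) ^ k / x := by positivity
      linarith [hdouble k]
    have hu_zero : What (u 0) = W := by
      rw [hW]; congr 1
      simpa [u] using hxinv
    have htail : ∀ k, What (u k) ≤ C ^ k * W := fun k => by
      induction k with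
      | zero => simp [hu_zero]
      | succ k ih =>
        have hmid : u k ≤ (1 + u (k + 1)) / 2 := by
          refine max_le (by linarith [hu0 (k + 1)]) ?_
          have : 1 - 2 ^ (k + 1) / x ≤ u (k + 1) := le_max_right _ _
          linarith [hdouble k]
        calc What (u (k + 1)) ≤ C * What ((1 + u (k + 1)) / 2) := hC _ ⟨hu0 _, hu1 _⟩
          _ ≤ C * What (u k) := by gcongr; exact hanti (hu0 k) hmid
          _ ≤ C * (C ^ k * W) := by gcongr
          _ = C ^ (k + 1) * W := by ring
    have hpartial : ∀ n, ∫ s in Ioc (u n) 1, s ^ x * ω s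
        ≤ (1 + 2 * A * (1 - (1 / 2) ^ n)) * W := fun n => by
      induction n with
      | zero =>
        have h := setIntegral_rpow_mul_le_exp (y := 0) hnn hI hx0 (hu0 0) le_rfl (by simp)
        rw [← hWhat, hu_zero] at h
        simpa using h
      | succ n ih =>
        have hsplit : ∫ s in Ioc (u (n + 1)) 1, s ^ x * ω s
            = (∫ s in Ioc (u (n + 1)) (u n), s ^ x * ω s)
              + ∫ s in Ioc (u n) 1, s ^ x * ω s := by
          rw [← Ioc_union_Ioc_eq_Ioc (hu_succ n) (hu1 n).le]
          exact setIntegral_union (Ioc_disjoint_Ioc_of_le le_rfl) measurableSet_Ioc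
            (hfI.mono_set (Ioc_subset_Ioc (hu0 _) (hu1 n).le))
            (hfI.mono_set (Ioc_subset_Ioc_left (hu0 n)))
        have hpiece : ∫ s in Ioc (u (n + 1)) (u n), s ^ x * ω s ≤ A * (1 / 2) ^ n * W := by
          have h := setIntegral_rpow_mul_le_exp (y := 2 ^ n) hnn hI hx0 (hu0 (n + 1))
            (hu1 n).le fun hlt =>
              ((le_max_iff.1 (le_refl (u n))).resolve_left
                (not_le.2 ((hu0 _).trans_lt hlt)))
          rw [← hWhat] at h
          calc _ ≤ Real.exp (-2 ^ n) * What (u (n + 1)) := h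
            _ ≤ Real.exp (-2 ^ n) * (C ^ (n + 1) * W) := by gcongr; exact htail _
            _ = C ^ (n + 1) * Real.exp (-2 ^ n) * W := by ring
            _ ≤ A * (1 / 2) ^ n * W := mul_le_mul_of_nonneg_right (hAk n) hW0.le
        rw [hsplit]
        calc _ ≤ A * (1 / 2) ^ n * W + (1 + 2 * A * (1 - (1 / 2) ^ n)) * W :=
              add_le_add hpiece ih
          _ = _ := by ring
    obtain ⟨n, hn⟩ := pow_unbounded_of_one_lt x (one_lt_two (α := ℝ))
    have hun : u n = 0 := by
      refine max_eq_left ?_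
      have : 1 ≤ 2 ^ n / x := (one_le_div hx0).2 hn.le
      linarith
    have h := hpartial n
    rw [hun, ← hmom] at h
    refine h.trans (mul_le_mul_of_nonneg_right ?_ hW0.le)
    have : 0 < A * (1 / 2) ^ n := by positivity
    linarith
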